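/- Let n >= 1 be an integer and K a field containing a primitive n-th root of unity zeta. Let Dzeta in GL_n(K) be the diagonal matrix with diagonal entries zeta^0, zeta^1, ..., zeta^{n-1}, and let P in GL_n(K) be the cyclic permutation matrix sending the standard basis vector e_i to e_{i+1} (indices mod n). Then the only K-subspaces U of K^n satisfying Dzeta(U) = U and P(U) = U are U = 0 and U = K^n; that is, the representation of the group generated by Dzeta and P on K^n is irreducible. -/

import Mathlib

open Matrix

open Fin.CommRing in
theorem fin_cyclic_induction (n : ℕ) [NeZero n] (k : Fin n) (p : Fin n → Prop)
    (h0 : p k) (hs : ∀ j, p j → p (j + 1)) : ∀ i, p i := by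
  have hshift : ∀ m : ℕ, p (k + (m : Fin n)) := by
    intro m
    induction m with
    | zero => simpa using h0
    | succ m ih =>
      have h := hs _ ih
      rwa [add_assoc, ← Nat.cast_succ] at h
  intro i
  have h := hshift ((i - k : Fin n) : ℕ)
  rwa [Fin.cast_val_eq_self, add_sub_cancel] at h

/-- The Schrödinger representation is irreducible: the only subspaces of `K^n`
invariant under both `Dζ = diag(1, ζ, ..., ζ^{n-1})` and the cyclic permutation
matrix `P` are `0` and `K^n`. -/
theorem schroedinger_representation_irreducible
    (n : ℕ) [NeZero n] (hn : 1 ≤ n) (K : Type*) [Field K] (ζ : K)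
    (hζ : IsPrimitiveRoot ζ n)
    (Dzeta P : Matrix (Fin n) (Fin n) K)
    (hD : Dzeta = Matrix.diagonal fun i : Fin n => ζ ^ (i : ℕ))
    (hP : P = Matrix.of fun i j : Fin n => if i = j + 1 then (1 : K) else 0) :
    ∀ U : Submodule K (Fin n → K),
      Submodule.map Dzeta.mulVecLin U = U →
      Submodule.map P.mulVecLin U = U →
      U = ⊥ ∨ U = ⊤ := by
  intro U hDU hPU
  have hDm : ∀ v ∈ U, (fun i : Fin n => ζ ^ (i : ℕ) * v i) ∈ U := by
    intro v hv
    have h : Dzeta.mulVecLin v ∈ U := by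
      rw [← hDU]
      exact Submodule.mem_map_of_mem hv
    have e : Dzeta.mulVecLin v = fun i : Fin n => ζ ^ (i : ℕ) * v i := by
      funext i
      rw [hD, Matrix.mulVecLin_apply, Matrix.mulVec_diagonal]
    rwa [e] at h
  have hPm : ∀ k : Fin n, (Pi.single k (1 : K) : Fin n → K) ∈ U →
      (Pi.single (k + 1) (1 : K) : Fin n → K) ∈ U := by
    intro k hv
    have h : P.mulVecLin (Pi.single k (1 : K)) ∈ U := by
      rw [← hPU]
      exact Submodule.mem_map_of_mem hv
    have e : P.mulVecLin (Pi.single k (1 : K)) = Pi.single (k + 1) (1 : K) := by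
      funext i
      rw [hP, Matrix.mulVecLin_apply, Matrix.mulVec_single_one]
      simp [Pi.single_apply]
    rwa [e] at h
  by_cases hU : U = ⊥
  · exact Or.inl hU
  right
  obtain ⟨v, hv, hv0⟩ := (Submodule.ne_bot_iff U).1 hU
  obtain ⟨k, hk⟩ := Function.ne_iff.1 hv0
  have hprod : ∀ S : Finset (Fin n),
      (fun i : Fin n => (∏ j ∈ S, (ζ ^ (i : ℕ) - ζ ^ (j : ℕ))) * v i) ∈ U := by
    intro S
    induction S using Finset.induction_on with
    | empty => simpa using hv
    | insert a S ha ih =>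
      have h := U.sub_mem (hDm _ ih) (U.smul_mem (ζ ^ (a : ℕ)) ih)
      convert h using 1
      funext i
      rw [Finset.prod_insert ha]
      simp only [Pi.sub_apply, Pi.smul_apply, smul_eq_mul]
      ring
  have hek : (Pi.single k (1 : K) : Fin n → K) ∈ U := by
    have hc : (∏ j ∈ Finset.univ.erase k, (ζ ^ (k : ℕ) - ζ ^ (j : ℕ))) * v k ≠ 0 := by
      refine mul_ne_zero (Finset.prod_ne_zero_iff.2 ?_) hk
      intro j hj h
      exact (Finset.ne_of_mem_erase hj)
        (Fin.ext (hζ.pow_inj k.2 j.2 (sub_eq_zero.1 h))).symm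
    have h := U.smul_mem
      ((∏ j ∈ Finset.univ.erase k, (ζ ^ (k : ℕ) - ζ ^ (j : ℕ))) * v k)⁻¹
      (hprod (Finset.univ.erase k))
    convert h using 1
    funext i
    rw [Pi.smul_apply, smul_eq_mul]
    by_cases hik : i = k
    · subst hik
      rw [Pi.single_eq_same, inv_mul_cancel₀ hc]
    · have hz : (∏ j ∈ Finset.univ.erase k, (ζ ^ (i : ℕ) - ζ ^ (j : ℕ))) = 0 :=
        Finset.prod_eq_zero (i := i) (by simp [hik]) (sub_self _)
      rw [Pi.single_eq_of_ne hik, hz, zero_mul, mul_zero]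
  have hall : ∀ i : Fin n, (Pi.single i (1 : K) : Fin n → K) ∈ U :=
    fin_cyclic_induction n k (fun i => (Pi.single i (1 : K) : Fin n → K) ∈ U) hek hPm
  rw [eq_top_iff]
  intro w _
  rw [pi_eq_sum_univ' w]
  refine U.sum_mem fun i _ => U.smul_mem _ ?_
  convert hall i using 1
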